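/- Let U be a finite set of features and let 𝓕 be a nonempty family of subsets of U with ∅ ∉ 𝓕. Define the model M : (U → Bool) → Bool by M(e) = true if and only if there exists F' ∈ 𝓕 with F' ⊆ {u ∈ U : e(u) = true}. Let e₀ be the all-zero example and e_U the all-one example over U. Then a set S ⊆ U is a local abductive explanation for e₀ w.r.t. M if and only if S is a local contrastive explanation for e_U w.r.t. M. -/

import Mathlib

/-- `A` is a local abductive explanation (lAXp) for example `e` w.r.t. model `M`. -/
def IsLAXp {U : Type*} (M : (U → Bool) → Bool) (e : U → Bool) (A : Set U) : Prop :=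
  ∀ e' : U → Bool, (∀ u ∈ A, e' u = e u) → M e' = M e

/-- `A` is a local contrastive explanation (lCXp) for example `e` w.r.t. model `M`. -/
def IsLCXp {U : Type*} (M : (U → Bool) → Bool) (e : U → Bool) (A : Set U) : Prop :=
  ∃ e' : U → Bool, M e' ≠ M e ∧ ∀ u : U, e' u ≠ e u → u ∈ A

/-- The model classifying `e` positively iff some member of `𝓕` is contained in the
set of features set to `true` by `e`. -/
def subsetModel {U : Type*} [Fintype U] [DecidableEq U] (𝓕 : Finset (Finset U)) :
    (U → Bool) → Bool :=
  fun e => decide (∃ F' ∈ 𝓕, F' ⊆ Finset.univ.filter fun u => e u = true)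

theorem subsetModel_eq_true_iff {U : Type*} [Fintype U] [DecidableEq U]
    {𝓕 : Finset (Finset U)} {e : U → Bool} :
    subsetModel 𝓕 e = true ↔ ∃ F ∈ 𝓕, ∀ u ∈ F, e u = true := by
  simp [subsetModel, Finset.subset_iff]

theorem subsetModel_mono {U : Type*} [Fintype U] [DecidableEq U]
    {𝓕 : Finset (Finset U)} {e e' : U → Bool} (h : ∀ u, e u = true → e' u = true)
    (he : subsetModel 𝓕 e = true) : subsetModel 𝓕 e' = true := by
  rw [subsetModel_eq_true_iff] at he ⊢
  obtain ⟨F, hF, hFe⟩ := he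
  exact ⟨F, hF, fun u hu => h u (hFe u hu)⟩

theorem subsetModel_const_false {U : Type*} [Fintype U] [DecidableEq U]
    {𝓕 : Finset (Finset U)} (hF : ∅ ∉ 𝓕) : subsetModel 𝓕 (fun _ => false) = false := by
  rw [← Bool.not_eq_true, subsetModel_eq_true_iff]
  rintro ⟨F, hmem, h⟩
  have hempty : F = ∅ :=
    Finset.eq_empty_of_forall_notMem fun u hu => Bool.false_ne_true (h u hu)
  exact hF (hempty ▸ hmem)

theorem subsetModel_const_true {U : Type*} [Fintype U] [DecidableEq U]
    {𝓕 : Finset (Finset U)} (hne : 𝓕.Nonempty) : subsetModel 𝓕 (fun _ => true) = true := by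
  obtain ⟨F, hF⟩ := hne
  exact subsetModel_eq_true_iff.mpr ⟨F, hF, fun _ _ => rfl⟩

theorem stmt5 (U : Type*) [Fintype U] [DecidableEq U]
    (𝓕 : Finset (Finset U)) (hne : 𝓕.Nonempty) (hF : ∅ ∉ 𝓕) (S : Finset U) :
    IsLAXp (subsetModel 𝓕) (fun _ => false) (↑S : Set U) ↔
      IsLCXp (subsetModel 𝓕) (fun _ => true) (↑S : Set U) := by
  unfold IsLAXp IsLCXp
  rw [subsetModel_const_false hF, subsetModel_const_true hne]
  constructor
  · intro h
    refine ⟨fun u => decide (u ∉ S), ?_, fun u hu => by simpa using hu⟩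
    rw [h _ fun u hu => by simpa using hu]
    exact Bool.false_ne_true
  · rintro ⟨e, he, hS⟩ e' h'
    rw [← Bool.not_eq_true]
    refine fun ht => he (subsetModel_mono (fun u hu => ?_) ht)
    by_contra hne'
    exact Bool.false_ne_true ((h' u (hS u hne')).symm.trans hu)
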